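/- arXiv:2403.04768 — 3 statements merged into one kernel-verified Lean document; each statement's English description precedes it below -/
import Mathlib

section
/- Let y > 0, α ∈ [0, 2π), β ∈ (0, π/2). Then the sum of 1/p over all primes p such that y·ln p + α ∈ (2nπ − β, 2nπ + β] for some nonnegative integer n diverges. -/
open Real

open Filter Topology MeasureTheory AddCircle in
/-- **Weyl's criterion** for weighted averages: if the averages of all Fourier monomials converge to
their integrals, then so do the averages of all continuous functions. -/
theorem tendsto_tsum_mul_of_tendsto_fourier {T : ℝ} [Fact (0 < T)] {X ι : Type*} {l : Filter X}
    {w : X → ι → ℂ} {θ : ι → AddCircle T} {C : ℝ}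
    (hw : ∀ᶠ x in l, Summable (fun i ↦ ‖w x i‖)) (hC : ∀ᶠ x in l, ∑' i, ‖w x i‖ ≤ C)
    (hfourier : ∀ k : ℤ, Tendsto (fun x ↦ ∑' i, w x i * fourier k (θ i)) l
      (𝓝 (∫ t : AddCircle T, fourier k t ∂haarAddCircle)))
    (f : C(AddCircle T, ℂ)) :
    Tendsto (fun x ↦ ∑' i, w x i * f (θ i)) l (𝓝 (∫ t, f t ∂haarAddCircle)) := by
  have norm_le (g : C(AddCircle T, ℂ)) (x : X) (i : ι) :
      ‖w x i * g (θ i)‖ ≤ ‖w x i‖ * ‖g‖ := by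
    rw [norm_mul]
    gcongr
    exact g.norm_coe_le_norm _
  have summable (g : C(AddCircle T, ℂ)) {x : X} (hx : Summable (fun i ↦ ‖w x i‖)) :
      Summable (fun i ↦ w x i * g (θ i)) :=
    .of_norm_bounded (hx.mul_right _) (norm_le g x)
  have integrable (g : C(AddCircle T, ℂ)) : Integrable g (haarAddCircle (T := T)) :=
    g.continuous.integrable_of_hasCompactSupport (.of_compactSpace _)
  have tendsto_span (g : C(AddCircle T, ℂ)) (hg : g ∈ Submodule.span ℂ (Set.range (@fourier T))) :
      Tendsto (fun x ↦ ∑' i, w x i * g (θ i)) l (𝓝 (∫ t, g t ∂haarAddCircle)) := by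
    induction hg using Submodule.span_induction with
    | mem g hg =>
      obtain ⟨k, rfl⟩ := hg
      exact hfourier k
    | zero => simpa using tendsto_const_nhds
    | add g h _ _ ihg ihh =>
      simp only [ContinuousMap.add_apply]
      rw [integral_add (integrable g) (integrable h)]
      refine (ihg.add ihh).congr' ?_
      filter_upwards [hw] with x hx
      rw [← (summable g hx).tsum_add (summable h hx)]
      simp only [mul_add]
    | smul c g _ ih =>
      simp only [ContinuousMap.smul_apply, smul_eq_mul]
      rw [integral_const_mul]
      refine (ih.const_mul c).congr fun x ↦ ?_
      rw [← tsum_mul_left]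
      simp only [mul_left_comm]
  rw [Metric.tendsto_nhds]
  intro ε hε
  have hf : f ∈ (Submodule.span ℂ (Set.range (@fourier T))).topologicalClosure := by
    rw [span_fourier_closure_eq_top]
    trivial
  obtain ⟨g, hg, hfg⟩ := Metric.mem_closure_iff.mp hf (ε / (2 * (|C| + 1))) (by positivity)
  rw [dist_eq_norm] at hfg
  have hδ : (|C| + 1) * ‖f - g‖ < ε / 2 := by
    calc (|C| + 1) * ‖f - g‖ < (|C| + 1) * (ε / (2 * (|C| + 1))) := by gcongr
      _ = ε / 2 := by field_simp
  filter_upwards [hw, hC, Metric.tendsto_nhds.mp (tendsto_span g hg) (ε / 2) (by positivity)]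
    with x hx hCx hgx
  have hsum : ‖∑' i, w x i * f (θ i) - ∑' i, w x i * g (θ i)‖ ≤ |C| * ‖f - g‖ := by
    rw [← (summable f hx).tsum_sub (summable g hx)]
    calc ‖∑' i, (w x i * f (θ i) - w x i * g (θ i))‖
        ≤ ∑' i, ‖w x i‖ * ‖f - g‖ := by
          refine tsum_of_norm_bounded (hx.mul_right _).hasSum fun i ↦ ?_
          simpa [mul_sub] using norm_le (f - g) x i
      _ = (∑' i, ‖w x i‖) * ‖f - g‖ := tsum_mul_right
      _ ≤ |C| * ‖f - g‖ := by
          gcongr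
          exact hCx.trans (le_abs_self C)
  have hint : ‖∫ t, g t ∂haarAddCircle - ∫ t, f t ∂haarAddCircle‖ ≤ ‖f - g‖ := by
    rw [← integral_sub (integrable g) (integrable f), norm_sub_rev f g]
    simpa using norm_integral_le_of_norm_le_const (μ := haarAddCircle (T := T))
      (.of_forall fun t ↦ (g - f).norm_coe_le_norm t)
  rw [dist_eq_norm] at hgx ⊢
  calc _ = ‖(∑' i, w x i * f (θ i) - ∑' i, w x i * g (θ i))
        + (∑' i, w x i * g (θ i) - ∫ t, g t ∂haarAddCircle)
        + (∫ t, g t ∂haarAddCircle - ∫ t, f t ∂haarAddCircle)‖ := by congr 1; ring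
    _ ≤ _ := norm_add₃_le
    _ < ε := by linarith

open MeasureTheory AddCircle in
theorem integral_fourier_eq_ite {T : ℝ} [Fact (0 < T)] (k : ℤ) :
    ∫ t : AddCircle T, fourier k t ∂haarAddCircle = if k = 0 then 1 else 0 := by
  split_ifs with hk
  · simp [hk]
  · exact integral_eq_zero_of_add_right_eq_neg (fourier_add_half_inv_index hk Fact.out)

open Filter Topology in
theorem tendsto_mul_neg_deriv_riemannZeta_div (τ : ℝ) :
    Tendsto (fun x : ℝ ↦ (x : ℂ) * (-deriv riemannZeta (1 + x + τ * Complex.I) /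
      riemannZeta (1 + x + τ * Complex.I))) (𝓝[>] 0) (𝓝 (if τ = 0 then 1 else 0)) := by
  have hx : Tendsto (fun x : ℝ ↦ (x : ℂ)) (𝓝[>] 0) (𝓝 0) :=
    (Complex.continuous_ofReal.tendsto' 0 0 (by simp)).mono_left nhdsWithin_le_nhds
  split_ifs with hτ
  · subst hτ
    have hlim : Tendsto (fun x : ℝ ↦ (1 + x : ℂ)) (𝓝[>] 0) (𝓝[≠] 1) := by
      refine tendsto_nhdsWithin_iff.mpr ⟨by simpa using hx.const_add 1, ?_⟩
      filter_upwards [self_mem_nhdsWithin] with x hx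
      simpa using hx.ne'
    have h := (log_deriv_riemannZeta_add_inv_sub_bounded.comp_tendsto hlim)
    have h0 : Tendsto (fun x : ℝ ↦ (x : ℂ) * (deriv riemannZeta (1 + x) / riemannZeta (1 + x)
        + (1 + x - 1 : ℂ)⁻¹)) (𝓝[>] 0) (𝓝 0) :=
      ((Asymptotics.isBigO_refl (fun x : ℝ ↦ (x : ℂ)) _).mul h).trans_tendsto (by simpa using hx)
    have := h0.const_sub 1
    rw [sub_zero] at this
    refine this.congr' ?_
    filter_upwards [self_mem_nhdsWithin] with x hx
    have : (x : ℂ) ≠ 0 := by simpa using (ne_of_gt hx)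
    simp only [Complex.ofReal_zero, zero_mul, add_zero, add_sub_cancel_left, mul_add,
      mul_inv_cancel₀ this]
    ring
  · have hne : (1 + τ * Complex.I : ℂ) ≠ 1 := by simpa using hτ
    have hζ : ContinuousAt (fun s ↦ -deriv riemannZeta s / riemannZeta s) (1 + τ * Complex.I) := by
      refine ContinuousAt.div ?_ (differentiableAt_riemannZeta hne).continuousAt
        (riemannZeta_ne_zero_of_one_le_re (by simp))
      have : AnalyticAt ℂ riemannZeta (1 + τ * Complex.I) :=
        differentiableOn_riemannZeta.analyticAt (isOpen_compl_singleton.mem_nhds hne)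
      exact this.deriv.continuousAt.neg
    have hlim : Tendsto (fun x : ℝ ↦ (1 + x + τ * Complex.I : ℂ)) (𝓝[>] 0)
        (𝓝 (1 + τ * Complex.I)) := by
      simpa using (hx.const_add 1).add_const (τ * Complex.I)
    simpa using hx.mul (hζ.tendsto.comp hlim)

section vonMangoldtWeights

open ArithmeticFunction hiding log
open Filter Topology MeasureTheory AddCircle

/-- The weight `x * Λ n / n ^ (1 + x)`; the total mass of these weights tends to `1` as `x → 0⁺`. -/
noncomputable def vonMangoldtWeight (x : ℝ) (n : ℕ) : ℝ := x * (Λ n / (n : ℝ) ^ (1 + x))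

theorem vonMangoldtWeight_nonneg {x : ℝ} (hx : 0 ≤ x) (n : ℕ) : 0 ≤ vonMangoldtWeight x n := by
  have := vonMangoldt_nonneg (n := n)
  unfold vonMangoldtWeight
  positivity

theorem vonMangoldtWeight_le {x : ℝ} (hx0 : 0 ≤ x) (hx1 : x ≤ 1) (n : ℕ) :
    vonMangoldtWeight x n ≤ Λ n / n := by
  rcases n.eq_zero_or_pos with rfl | hn
  · simp [vonMangoldtWeight]
  have hn1 : (1 : ℝ) ≤ n := mod_cast hn
  have hΛ := vonMangoldt_nonneg (n := n)
  calc vonMangoldtWeight x n ≤ 1 * (Λ n / (n : ℝ) ^ (1 : ℝ)) := by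
        unfold vonMangoldtWeight
        gcongr
        linarith
    _ = Λ n / n := by simp

theorem vonMangoldtWeight_prime_le (x : ℝ) {p : ℕ} (hp : p.Prime) :
    vonMangoldtWeight x p ≤ 1 / p := by
  have hp0 : (0 : ℝ) < p := mod_cast hp.pos
  rw [vonMangoldtWeight, vonMangoldt_apply_prime hp, rpow_add hp0, rpow_one, ← mul_div_assoc,
    ← div_div, div_right_comm]
  gcongr
  rw [div_le_one (by positivity), ← log_rpow hp0]
  exact log_le_self (by positivity)

theorem tendsto_vonMangoldtWeight (n : ℕ) :
    Tendsto (fun x ↦ vonMangoldtWeight x n) (𝓝[>] 0) (𝓝 0) := by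
  rcases n.eq_zero_or_pos with rfl | hn
  · simp [vonMangoldtWeight]
  have hn0 : (n : ℝ) ≠ 0 := mod_cast hn.ne'
  have : ContinuousAt (fun x : ℝ ↦ vonMangoldtWeight x n) 0 := by
    unfold vonMangoldtWeight
    fun_prop (disch := first | simp [hn0] | positivity)
  simpa [vonMangoldtWeight] using this.tendsto.mono_left nhdsWithin_le_nhds

theorem vonMangoldtWeight_mul_fourier (x y α : ℝ) (k : ℤ) (n : ℕ) :
    (vonMangoldtWeight x n : ℂ) * fourier k ((y * log n + α : ℝ) : AddCircle (2 * π)) =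
      Complex.exp (k * α * Complex.I) * (x * LSeries.term (fun n ↦ (Λ n : ℂ))
        (1 + x + (-(k * y) : ℝ) * Complex.I) n) := by
  rcases n.eq_zero_or_pos with rfl | hn
  · simp [vonMangoldtWeight]
  have hn0 : (n : ℂ) ≠ 0 := mod_cast hn.ne'
  have hπ : (π : ℂ) ≠ 0 := mod_cast pi_ne_zero
  have hlog : Complex.log n = (log n : ℝ) := Complex.natCast_log.symm
  have hfourier : fourier k ((y * log n + α : ℝ) : AddCircle (2 * π)) =
      Complex.exp (k * α * Complex.I) * (n : ℂ) ^ (k * y * Complex.I) := by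
    rw [fourier_coe_apply, Complex.cpow_def_of_ne_zero hn0, ← Complex.exp_add, hlog]
    congr 1
    push_cast
    field_simp
    ring
  have hcpow : (n : ℂ) ^ (1 + x + (-(k * y) : ℝ) * Complex.I) =
      (n : ℂ) ^ (1 + x : ℂ) / (n : ℂ) ^ (k * y * Complex.I) := by
    rw [← Complex.cpow_sub _ _ hn0]
    push_cast
    ring_nf
  rw [hfourier, LSeries.term_of_ne_zero hn.ne', hcpow, vonMangoldtWeight]
  have h1 : (n : ℂ) ^ (1 + x : ℂ) ≠ 0 := by simp [Complex.cpow_eq_zero_iff, hn0]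
  have h2 : (n : ℂ) ^ (k * y * Complex.I) ≠ 0 := by simp [Complex.cpow_eq_zero_iff, hn0]
  push_cast [Complex.ofReal_cpow (Nat.cast_nonneg n)]
  field_simp

theorem summable_vonMangoldtWeight {x : ℝ} (hx : 0 < x) : Summable (vonMangoldtWeight x) := by
  have h := (LSeriesSummable_vonMangoldt (s := 1 + x + (-((0 : ℤ) * 0) : ℝ) * Complex.I)
    (by simpa using hx)).mul_left (x : ℂ)
  refine Complex.summable_ofReal.mp (h.congr fun n ↦ ?_)
  simpa using (vonMangoldtWeight_mul_fourier x 0 0 0 n).symm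

theorem tendsto_tsum_vonMangoldtWeight_mul_fourier {y : ℝ} (hy : y ≠ 0) (α : ℝ) (k : ℤ) :
    Tendsto (fun x : ℝ ↦ ∑' n, (vonMangoldtWeight x n : ℂ) *
      fourier k ((y * log n + α : ℝ) : AddCircle (2 * π))) (𝓝[>] 0)
      (𝓝 (if k = 0 then 1 else 0)) := by
  have h := (tendsto_mul_neg_deriv_riemannZeta_div (-(k * y))).const_mul
    (Complex.exp (k * α * Complex.I))
  convert h.congr' ?_ using 2
  · by_cases hk : k = 0 <;> simp [hk, hy]
  · filter_upwards [self_mem_nhdsWithin] with x hx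
    have hs : 1 < (1 + x + (-(k * y) : ℝ) * Complex.I : ℂ).re := by simpa using hx
    simp only [vonMangoldtWeight_mul_fourier, tsum_mul_left]
    rw [← LSeries_vonMangoldt_eq_deriv_riemannZeta_div hs, LSeries]

/-- As `x → 0⁺`, the points `y * log n + α` modulo `2π`, weighted by `vonMangoldtWeight x`,
equidistribute on the circle. -/
theorem tendsto_tsum_vonMangoldtWeight_mul [Fact (0 < 2 * π)] {y : ℝ} (hy : y ≠ 0) (α : ℝ)
    (f : C(AddCircle (2 * π), ℂ)) :
    Tendsto (fun x : ℝ ↦ ∑' n : ℕ, (vonMangoldtWeight x n : ℂ) *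
      f ((y * log n + α : ℝ) : AddCircle (2 * π))) (𝓝[>] 0) (𝓝 (∫ t, f t ∂haarAddCircle)) := by
  have norm_eq {x : ℝ} (hx : 0 < x) (n : ℕ) :
      ‖(vonMangoldtWeight x n : ℂ)‖ = vonMangoldtWeight x n := by
    rw [Complex.norm_real, norm_of_nonneg (vonMangoldtWeight_nonneg hx.le n)]
  refine tendsto_tsum_mul_of_tendsto_fourier (C := 2) ?_ ?_ (fun k ↦ ?_) f
  · filter_upwards [self_mem_nhdsWithin] with x hx
    simpa only [norm_eq hx] using summable_vonMangoldtWeight hx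
  · have hmass : Tendsto (fun x ↦ ∑' n, vonMangoldtWeight x n) (𝓝[>] 0) (𝓝 1) := by
      have h := tendsto_tsum_vonMangoldtWeight_mul_fourier hy α 0
      simp only [fourier_zero, mul_one, if_true, ← Complex.ofReal_tsum] at h
      exact tendsto_ofReal_iff.mp h
    filter_upwards [self_mem_nhdsWithin, hmass.eventually_le_const one_lt_two] with x hx hle
    simpa only [norm_eq hx] using hle
  · rw [integral_fourier_eq_ite]
    exact tendsto_tsum_vonMangoldtWeight_mul_fourier hy α k

end vonMangoldtWeights

/-- If `cos β < cos θ`, then `θ` is within `β` of a multiple of `2π`. -/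
theorem exists_int_abs_sub_lt_of_cos_lt_cos {θ β : ℝ} (hβ0 : 0 ≤ β)
    (h : cos β < cos θ) : ∃ n : ℤ, |θ - n * (2 * π)| < β := by
  refine ⟨round (θ / (2 * π)), ?_⟩
  by_contra! hle
  have hπ : |θ - round (θ / (2 * π)) * (2 * π)| ≤ π := by
    have h := abs_sub_round (θ / (2 * π))
    have h2 : θ - round (θ / (2 * π)) * (2 * π) =
        (θ / (2 * π) - round (θ / (2 * π))) * (2 * π) := by
      field_simp
    rw [h2, abs_mul, abs_of_pos two_pi_pos]
    nlinarith [pi_pos]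
  have := cos_le_cos_of_nonneg_of_le_pi hβ0 hπ hle
  rw [cos_abs, cos_sub_int_mul_two_pi] at this
  linarith

open ArithmeticFunction hiding log in
open Filter Topology MeasureTheory AddCircle in
theorem stmt_11 (y α β : ℝ) (hy : 0 < y) (hα0 : 0 ≤ α) (hα2 : α < 2 * π)
    (hβ0 : 0 < β) (hβπ : β < π / 2) :
    ¬ Summable (fun p : {p : ℕ // p.Prime ∧ ∃ n : ℕ,
        2 * n * π - β < y * Real.log p + α ∧ y * Real.log p + α ≤ 2 * n * π + β} =>
      (1 : ℝ) / p) := by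
  intro hsum
  have : Fact (0 < 2 * π) := ⟨two_pi_pos⟩
  set A : Set ℕ := {p : ℕ | p.Prime ∧ ∃ n : ℕ,
        2 * n * π - β < y * Real.log p + α ∧ y * Real.log p + α ≤ 2 * n * π + β}
  have hsumA : Summable (A.indicator fun p : ℕ ↦ (1 : ℝ) / p) :=
    summable_subtype_iff_indicator.mp hsum
  let g : C(AddCircle (2 * π), ℝ) :=
    ⟨fun t ↦ max 0 ((fourier 1 t).re - cos β), by fun_prop⟩
  have g_coe (θ : ℝ) : g θ = max 0 (cos θ - cos β) := by
    have : fourier 1 (θ : AddCircle (2 * π)) = Complex.exp (θ * Complex.I) := by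
      rw [fourier_coe_apply]
      congr 1
      push_cast
      field_simp
    change max 0 ((fourier 1 (θ : AddCircle (2 * π))).re - cos β) = _
    rw [this, Complex.exp_ofReal_mul_I_re]
  have g_nonneg (t : AddCircle (2 * π)) : 0 ≤ g t := le_max_left _ _
  have g_eq_zero {p : ℕ} (hp : p.Prime) (hpA : p ∉ A) : g (y * log p + α : ℝ) = 0 := by
    rw [g_coe, max_eq_left]
    by_contra! hlt
    obtain ⟨n, hn⟩ := exists_int_abs_sub_lt_of_cos_lt_cos hβ0.le (sub_pos.mp hlt)
    rw [abs_lt] at hn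
    have hn0 : 0 ≤ n := by
      have : 0 < y * log p := mul_pos hy (log_pos (mod_cast hp.one_lt))
      have h1 : (-1 : ℝ) < n := by
        by_contra! h
        nlinarith [pi_pos]
      have h2 : (-1 : ℤ) < n := mod_cast h1
      lia
    lift n to ℕ using hn0
    push_cast at hn
    exact hpA ⟨hp, n, by linarith, by linarith⟩
  have g_le (t : AddCircle (2 * π)) : g t ≤ ‖g‖ := (le_abs_self _).trans (g.norm_coe_le_norm t)
  have integral_pos : 0 < ∫ t, g t ∂haarAddCircle (T := 2 * π) := by
    refine g.continuous.integral_pos_of_hasCompactSupport_nonneg_nonzero (x := ((0 : ℝ) : _))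
      (.of_compactSpace _) g_nonneg ?_
    rw [g_coe]
    have := cos_lt_cos_of_nonneg_of_le_pi_div_two le_rfl hβπ.le hβ0
    exact (lt_max_of_lt_right (sub_pos.mpr this)).ne'
  have hlim : Tendsto (fun x : ℝ ↦ ∑' n : ℕ, vonMangoldtWeight x n * g (y * log n + α : ℝ))
      (𝓝[>] 0) (𝓝 (∫ t, g t ∂haarAddCircle)) := by
    have h := tendsto_tsum_vonMangoldtWeight_mul hy.ne' α
      ⟨fun t ↦ (g t : ℂ), by fun_prop⟩
    simp only [ContinuousMap.coe_mk, integral_complex_ofReal, ← Complex.ofReal_mul,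
      ← Complex.ofReal_tsum] at h
    exact tendsto_ofReal_iff.mp h
  have hlim0 : Tendsto (fun x : ℝ ↦ ∑' n : ℕ, vonMangoldtWeight x n * g (y * log n + α : ℝ))
      (𝓝[>] 0) (𝓝 (∑' _ : ℕ, 0)) := by
    have hbound : Summable fun n : ℕ ↦ ((if n.Prime then 0 else vonMangoldt.residueClass (q := 1) 0 n) / n
        + A.indicator (fun p : ℕ ↦ (1 : ℝ) / p) n) * ‖g‖ :=
      ((vonMangoldt.summable_residueClass_non_primes_div 0).add hsumA).mul_right _
    refine tendsto_tsum_of_dominated_convergence hbound (fun n ↦ ?_) ?_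
    · simpa using (tendsto_vonMangoldtWeight n).mul_const (g (y * log n + α : ℝ))
    · filter_upwards [Ioc_mem_nhdsGT zero_lt_one] with x hx n
      have hw := vonMangoldtWeight_nonneg hx.1.le n
      rw [norm_of_nonneg (mul_nonneg hw (g_nonneg _))]
      by_cases hn : n.Prime
      · by_cases hnA : n ∈ A
        · simp only [hn, hnA, if_true, zero_div, zero_add, Set.indicator_of_mem]
          exact mul_le_mul (vonMangoldtWeight_prime_le x hn) (g_le _) (g_nonneg _)
            (by positivity)
        · rw [g_eq_zero hn hnA]
          simp [hn, hnA]
      · have hnA : n ∉ A := fun h ↦ hn h.1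
        have hres : vonMangoldt.residueClass (q := 1) 0 n = vonMangoldt n := by
          simp [vonMangoldt.residueClass, Subsingleton.elim (n : ZMod 1) 0]
        simp only [hn, hnA, if_false, not_false_eq_true, Set.indicator_of_notMem, add_zero, hres]
        exact mul_le_mul (vonMangoldtWeight_le hx.1.le hx.2 n) (g_le _) (g_nonneg _)
          (hw.trans (vonMangoldtWeight_le hx.1.le hx.2 n))
  rw [tsum_zero] at hlim0
  exact integral_pos.ne' (tendsto_nhds_unique hlim hlim0)
end

section
/- Let y > 0, α ∈ [0, 2π), β ∈ (0, π/2). Then the sum of 1/p over all primes p such that y·ln p + α ∈ ((2n+1)π − β, (2n+1)π + β] for some nonnegative integer n diverges. -/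
open Real

open Filter Topology
open ArithmeticFunction hiding log

/-- `(σ - 1) ∑ Λ(n) n ^ (-σ - it)` tends to minus the residue of the logarithmic derivative of `ζ` at `1 + it` as `σ ↓ 1`. -/
lemma tendsto_sub_one_mul_LSeries_vonMangoldt (t : ℝ) :
    Tendsto (fun σ : ℝ ↦ ((σ : ℂ) - 1) *
      LSeries (fun n ↦ (vonMangoldt n : ℂ)) (σ + t * Complex.I)) (𝓝[>] 1)
      (𝓝 (if t = 0 then 1 else 0)) := by
  set G := vonMangoldt.LFunctionResidueClassAux (1 : ZMod 1)
  have hσ : Tendsto (fun σ : ℝ ↦ (σ : ℂ) - 1) (𝓝[>] 1) (𝓝 0) := by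
    have : Continuous fun σ : ℝ ↦ (σ : ℂ) - 1 := by fun_prop
    simpa using (this.tendsto 1).mono_left nhdsWithin_le_nhds
  have hG : Tendsto (fun σ : ℝ ↦ G (σ + t * Complex.I)) (𝓝[>] 1)
      (𝓝 (G (1 + t * Complex.I))) := by
    have hcont := vonMangoldt.continuousOn_LFunctionResidueClassAux (1 : ZMod 1)
      (1 + t * Complex.I) (by simp)
    refine Tendsto.comp (g := G) hcont.tendsto (tendsto_nhdsWithin_iff.mpr ⟨?_, ?_⟩)
    · have : Continuous fun σ : ℝ ↦ (σ : ℂ) + t * Complex.I := by fun_prop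
      simpa using (this.tendsto 1).mono_left nhdsWithin_le_nhds
    · filter_upwards [self_mem_nhdsWithin] with σ hσ
      simpa using (Set.mem_Ioi.mp hσ).le
  have hpole : Tendsto (fun σ : ℝ ↦ ((σ : ℂ) - 1) / ((σ : ℂ) - 1 + t * Complex.I)) (𝓝[>] 1)
      (𝓝 (if t = 0 then 1 else 0)) := by
    split_ifs with ht
    · refine tendsto_const_nhds.congr' ?_
      filter_upwards [self_mem_nhdsWithin] with σ hσ
      have : (σ : ℂ) - 1 ≠ 0 := by
        rw [sub_ne_zero]
        exact_mod_cast (Set.mem_Ioi.mp hσ).ne'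
      simp [ht, div_self this]
    · have := hσ.div (hσ.add_const (t * Complex.I)) (by simpa using ht)
      rw [zero_div] at this
      exact this
  have hlim := (hσ.mul hG).add hpole
  rw [zero_mul, zero_add] at hlim
  refine hlim.congr' ?_
  filter_upwards [self_mem_nhdsWithin] with σ hσ
  have h := vonMangoldt.eqOn_LFunctionResidueClassAux (isUnit_one (M := ZMod 1))
    (show (σ + t * Complex.I : ℂ) ∈ {s : ℂ | 1 < s.re} by simpa using hσ)
  have hres : vonMangoldt.residueClass (1 : ZMod 1) = vonMangoldt := by
    ext n
    simp [vonMangoldt.residueClass, Subsingleton.elim (n : ZMod 1) 1]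
  simp only [hres, Nat.totient_one, Nat.cast_one, inv_one] at h
  simp only [G, h]
  ring

lemma summable_vonMangoldt_div_rpow {σ : ℝ} (hσ : 1 < σ) :
    Summable fun n : ℕ ↦ vonMangoldt n / (n : ℝ) ^ σ := by
  have h := (LSeriesSummable_vonMangoldt (s := σ) (by simpa using hσ)).norm
  refine h.congr fun n ↦ ?_
  rcases eq_or_ne n 0 with rfl | hn
  · simp
  · simp [LSeries.term_of_ne_zero hn, abs_of_nonneg vonMangoldt_nonneg,
      Complex.norm_natCast_cpow_of_pos (Nat.pos_of_ne_zero hn)]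

lemma LSeries_term_vonMangoldt_mul_exp (σ y φ : ℝ) (k : ℤ) (n : ℕ) :
    ((vonMangoldt n / (n : ℝ) ^ σ : ℝ) : ℂ) * Complex.exp ((y * log n + φ : ℝ) * Complex.I) ^ k =
      Complex.exp (k * (φ * Complex.I)) *
        LSeries.term (fun n ↦ (vonMangoldt n : ℂ)) (σ + (-(k * y) : ℝ) * Complex.I) n := by
  rcases eq_or_ne n 0 with rfl | hn
  · simp
  · have hn' : (n : ℂ) ≠ 0 := by exact_mod_cast hn
    rw [LSeries.term_of_ne_zero hn, ← Complex.exp_int_mul, Complex.ofReal_div,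
      Complex.ofReal_cpow (Nat.cast_nonneg n), Complex.ofReal_natCast,
      Complex.cpow_def_of_ne_zero hn', Complex.cpow_def_of_ne_zero hn', div_eq_mul_inv,
      div_eq_mul_inv, ← Complex.exp_neg, ← Complex.exp_neg, mul_assoc,
      mul_left_comm (Complex.exp _) (vonMangoldt n : ℂ), ← Complex.exp_add, ← Complex.exp_add]
    congr 2
    push_cast [Complex.ofReal_log (Nat.cast_nonneg n)]
    ring

/-- Equidistribution of the phases `y log n + φ` against the characters of the circle,
with weights `Λ(n) n ^ (-σ)`, as `σ ↓ 1`. -/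
lemma tendsto_tsum_vonMangoldt_mul_exp {y : ℝ} (hy : y ≠ 0) (φ : ℝ) (k : ℤ) :
    Tendsto (fun σ : ℝ ↦ ((σ : ℂ) - 1) * ∑' n : ℕ, ((vonMangoldt n / (n : ℝ) ^ σ : ℝ) : ℂ) *
      Complex.exp ((y * log n + φ : ℝ) * Complex.I) ^ k) (𝓝[>] 1)
      (𝓝 (if k = 0 then 1 else 0)) := by
  have h := (tendsto_sub_one_mul_LSeries_vonMangoldt (-(k * y))).const_mul
    (Complex.exp (k * (φ * Complex.I)))
  have hlim : Complex.exp (k * (φ * Complex.I)) * (if -(k * y) = 0 then 1 else 0) =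
      if k = 0 then 1 else 0 := by
    rcases eq_or_ne k 0 with rfl | hk
    · simp
    · simp [hk, hy]
  rw [hlim] at h
  refine h.congr fun σ ↦ ?_
  simp_rw [LSeries_term_vonMangoldt_mul_exp, tsum_mul_left, LSeries]
  ring

lemma two_add_two_cos_pow_eq_sum (θ : ℝ) (N : ℕ) :
    (((2 + 2 * cos θ) ^ N : ℝ) : ℂ) = ∑ j ∈ Finset.range (2 * N + 1),
      ((2 * N).choose j : ℂ) * Complex.exp (θ * Complex.I) ^ ((j : ℤ) - N) := by
  set u := Complex.exp (θ * Complex.I)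
  have hu : u ≠ 0 := Complex.exp_ne_zero _
  have hbase : ((2 + 2 * cos θ : ℝ) : ℂ) = (u + 1) ^ 2 * u⁻¹ := by
    push_cast
    rw [Complex.two_cos, neg_mul, Complex.exp_neg]
    field_simp
    ring
  rw [Complex.ofReal_pow, hbase, mul_pow, ← pow_mul, add_pow, Finset.sum_mul]
  refine Finset.sum_congr rfl fun j _ ↦ ?_
  rw [zpow_sub₀ hu, zpow_natCast, zpow_natCast]
  rw [one_pow, inv_pow]
  ring

lemma tendsto_tsum_vonMangoldt_mul_two_add_two_cos_pow {y : ℝ} (hy : y ≠ 0) (φ : ℝ) (N : ℕ) :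
    Tendsto (fun σ : ℝ ↦ (σ - 1) * ∑' n : ℕ, vonMangoldt n / (n : ℝ) ^ σ *
      (2 + 2 * cos (y * log n + φ)) ^ N) (𝓝[>] 1) (𝓝 (N.centralBinom : ℝ)) := by
  have h := tendsto_finsetSum (Finset.range (2 * N + 1)) fun j _ ↦
    (tendsto_tsum_vonMangoldt_mul_exp hy φ ((j : ℤ) - N)).const_mul ((2 * N).choose j : ℂ)
  have hlim : ∑ j ∈ Finset.range (2 * N + 1),
      ((2 * N).choose j : ℂ) * (if (j : ℤ) - N = 0 then 1 else 0) = (N.centralBinom : ℂ) := by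
    simp only [sub_eq_zero, Nat.cast_inj, mul_ite, mul_one, mul_zero, Finset.sum_ite_eq',
      Finset.mem_range]
    rw [if_pos (by lia), Nat.centralBinom]
  rw [hlim] at h
  rw [← Complex.ofReal_natCast] at h
  have hre := (Complex.continuous_re.tendsto _).comp h
  rw [Complex.ofReal_re] at hre
  refine hre.congr' ?_
  filter_upwards [self_mem_nhdsWithin] with σ hσ
  have hsummable (k : ℤ) : Summable fun n : ℕ ↦ ((vonMangoldt n / (n : ℝ) ^ σ : ℝ) : ℂ) *
      Complex.exp ((y * log n + φ : ℝ) * Complex.I) ^ k := by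
    refine .of_norm ((summable_vonMangoldt_div_rpow hσ).norm.congr fun n ↦ ?_)
    rw [norm_mul, norm_zpow, Complex.norm_exp_ofReal_mul_I, one_zpow, mul_one, Complex.norm_real]
  rw [Function.comp_apply, ← Complex.ofReal_re ((σ - 1) * _)]
  congr 1
  rw [Complex.ofReal_mul, Complex.ofReal_sub, Complex.ofReal_one, Complex.ofReal_tsum]
  simp_rw [mul_left_comm _ ((σ : ℂ) - 1)]
  rw [← Finset.mul_sum]
  simp_rw [← tsum_mul_left (a := (Nat.choose _ _ : ℂ))]
  rw [← Summable.tsum_finsetSum fun j _ ↦ (hsummable _).mul_left _]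
  congr 1
  refine tsum_congr fun n ↦ ?_
  rw [Complex.ofReal_mul, two_add_two_cos_pow_eq_sum, Finset.mul_sum]
  exact Finset.sum_congr rfl fun j _ ↦ by ring

lemma summable_vonMangoldt_div_of_not_prime :
    Summable fun n : ℕ ↦ (if n.Prime then 0 else vonMangoldt n) / (n : ℝ) := by
  refine (vonMangoldt.summable_residueClass_non_primes_div (1 : ZMod 1)).congr fun n ↦ ?_
  simp [vonMangoldt.residueClass, Subsingleton.elim (n : ZMod 1) 1]

/-- If the reciprocals of the primes in `A` are summable, then `A` has density zero
with respect to the weights `Λ(n) n ^ (-σ)` as `σ ↓ 1`. -/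
lemma tendsto_tsum_indicator_vonMangoldt_of_summable (A : Set ℕ)
    (hA : Summable ({p ∈ A | p.Prime}.indicator fun p : ℕ ↦ 1 / (p : ℝ))) :
    Tendsto (fun σ : ℝ ↦ (σ - 1) * ∑' n : ℕ, A.indicator (fun n ↦ vonMangoldt n / (n : ℝ) ^ σ) n)
      (𝓝[>] 1) (𝓝 0) := by
  simp_rw [← tsum_mul_left]
  rw [← tsum_zero (α := ℝ) (β := ℕ)]
  refine tendsto_tsum_of_dominated_convergence (hA.add summable_vonMangoldt_div_of_not_prime)
    (fun n ↦ ?_) ?_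
  · rcases eq_or_ne n 0 with rfl | hn
    · simp [Set.indicator]
    · by_cases hnA : n ∈ A
      · have hn' : (n : ℝ) ≠ 0 := by exact_mod_cast hn
        have : ContinuousAt (fun σ : ℝ ↦ (σ - 1) * (vonMangoldt n / (n : ℝ) ^ σ)) 1 := by
          have := (Real.continuousAt_const_rpow (b := 1) hn')
          exact (by fun_prop : ContinuousAt (fun σ : ℝ ↦ σ - 1) 1).mul
            (continuousAt_const.div this (by simpa using hn))
        simpa [hnA] using this.tendsto.mono_left nhdsWithin_le_nhds
      · simp [hnA]
  · filter_upwards [Ioc_mem_nhdsGT (one_lt_two (α := ℝ))] with σ hσ n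
    have hσ0 : 0 < σ - 1 := sub_pos.mpr hσ.1
    rcases eq_or_ne n 0 with rfl | hn
    · simp [Set.indicator]
    have hn0 : (0 : ℝ) < n := by exact_mod_cast Nat.pos_of_ne_zero hn
    have hΛ : 0 ≤ vonMangoldt n := vonMangoldt_nonneg
    by_cases hnA : n ∈ A
    · rw [Set.indicator_of_mem hnA, norm_of_nonneg (by positivity)]
      by_cases hp : n.Prime
      · rw [Set.indicator_of_mem (by exact ⟨hnA, hp⟩), if_pos hp, zero_div, add_zero,
          vonMangoldt_apply_prime hp, ← sub_add_cancel σ 1, rpow_add_one hn0.ne',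
          add_sub_cancel_right, ← div_div, ← mul_div_assoc]
        gcongr
        rw [← mul_div_assoc, div_le_one (by positivity), rpow_def_of_pos hn0, mul_comm (log _)]
        linarith [add_one_le_exp ((σ - 1) * log n)]
      · rw [Set.indicator_of_notMem (by simp [hp]), if_neg hp, zero_add]
        calc (σ - 1) * (vonMangoldt n / (n : ℝ) ^ σ) ≤ 1 * (vonMangoldt n / (n : ℝ) ^ (1 : ℝ)) := by
              have h1 : (1 : ℝ) ≤ n := by exact_mod_cast Nat.one_le_iff_ne_zero.mpr hn
              gcongr
              · linarith [hσ.2]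
              · exact hσ.1.le
          _ = _ := by simp
    · rw [Set.indicator_of_notMem hnA, Set.indicator_of_notMem (by simp [hnA]), mul_zero, norm_zero,
        zero_add]
      split_ifs <;> positivity

lemma exists_pow_lt_centralBinom {K : ℝ} (hK0 : 0 ≤ K) (hK : K < 4) :
    ∃ N : ℕ, K ^ N < N.centralBinom := by
  have h := tendsto_self_mul_const_pow_of_lt_one (r := K / 4) (by positivity) (by linarith)
  obtain ⟨N, hN, hN4⟩ := ((h.eventually_lt_const one_pos).and (eventually_ge_atTop 4)).exists
  refine ⟨N, ?_⟩
  have hb : (4 : ℝ) ^ N < N * N.centralBinom := by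
    exact_mod_cast Nat.four_pow_lt_mul_centralBinom N hN4
  have hN0 : (0 : ℝ) < N := by exact_mod_cast (by lia : 0 < N)
  rw [div_pow, ← mul_div_assoc, div_lt_one (by positivity)] at hN
  exact lt_of_mul_lt_mul_left (hN.trans hb) hN0.le

/-- A point `x ≥ 0` where `cos (x - π)` exceeds `cos β` lies within `β` of an odd multiple
of `π`. -/
lemma exists_nat_odd_mul_pi_of_cos_lt {x β : ℝ} (hx : 0 ≤ x) (hβ0 : 0 < β) (hβπ : β < π / 2)
    (h : cos β < cos (x - π)) :
    ∃ n : ℕ, (2 * n + 1) * π - β < x ∧ x ≤ (2 * n + 1) * π + β := by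
  have hπ := pi_pos
  set m := round ((x - π) / (2 * π))
  set r := x - π - m * (2 * π) with hr
  have habs : |r| ≤ π := by
    have h1 := abs_sub_round ((x - π) / (2 * π))
    have h2 : r = ((x - π) / (2 * π) - m) * (2 * π) := by
      rw [hr]
      field_simp
    rw [h2, abs_mul, abs_of_pos (by positivity : 0 < 2 * π)]
    nlinarith
  have hlt : |r| < β := by
    by_contra! hle
    have := cos_le_cos_of_nonneg_of_le_pi hβ0.le habs hle
    rw [cos_abs, hr, cos_sub_int_mul_two_pi] at this
    linarith
  obtain ⟨h1, h2⟩ := abs_lt.mp hlt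
  have hm : 0 ≤ m := by
    by_contra! hneg
    have : (m : ℝ) ≤ -1 := by exact_mod_cast (by lia : m ≤ -1)
    nlinarith
  lift m to ℕ using hm with n hn
  refine ⟨n, ?_, ?_⟩ <;> simp only [Int.cast_natCast] at hr <;> linarith

theorem stmt_12 (y α β : ℝ) (hy : 0 < y) (hα0 : 0 ≤ α) (hα2 : α < 2 * π)
    (hβ0 : 0 < β) (hβπ : β < π / 2) :
    ¬ Summable (fun p : {p : ℕ // p.Prime ∧ ∃ n : ℕ,
        (2 * n + 1) * π - β < y * Real.log p + α ∧
          y * Real.log p + α ≤ (2 * n + 1) * π + β} =>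
      (1 : ℝ) / p) := by
  intro hsum
  set A : Set ℕ := {m | ∃ n : ℕ, (2 * n + 1) * π - β < y * Real.log m + α ∧
    y * Real.log m + α ≤ (2 * n + 1) * π + β}
  have hA : Summable ({p ∈ A | p.Prime}.indicator fun p : ℕ ↦ 1 / (p : ℝ)) := by
    have : {p ∈ A | p.Prime} = {p : ℕ | p.Prime ∧ p ∈ A} := by
      ext p
      exact and_comm
    rw [this]
    exact summable_subtype_iff_indicator.mp hsum
  have hcosβ : 0 ≤ cos β := cos_nonneg_of_mem_Icc ⟨by linarith, hβπ.le⟩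
  have hcosβ1 : cos β < 1 := by
    simpa using cos_lt_cos_of_nonneg_of_le_pi le_rfl (by linarith [pi_pos]) hβ0
  set K := 2 + 2 * cos β
  obtain ⟨N, hN⟩ := exists_pow_lt_centralBinom (K := K) (by positivity) (by simp only [K]; linarith)
  have hW := tendsto_tsum_vonMangoldt_mul_two_add_two_cos_pow hy.ne' (α - π) N
  have hone := tendsto_tsum_vonMangoldt_mul_two_add_two_cos_pow hy.ne' (α - π) 0
  simp only [pow_zero, mul_one, Nat.centralBinom_zero, Nat.cast_one] at hone
  have hzero := (tendsto_tsum_indicator_vonMangoldt_of_summable A hA).const_mul ((4 : ℝ) ^ N)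
  have hright := (hone.const_mul (K ^ N)).add hzero
  have hle : (N.centralBinom : ℝ) ≤ K ^ N * 1 + 4 ^ N * 0 := by
    refine le_of_tendsto_of_tendsto hW hright ?_
    filter_upwards [self_mem_nhdsWithin] with σ hσ
    have hs := summable_vonMangoldt_div_rpow hσ
    have hcos0 (x : ℝ) : 0 ≤ 2 + 2 * cos x := by linarith [neg_one_le_cos x]
    have hcos4 (x : ℝ) : (2 + 2 * cos x) ^ N ≤ 4 ^ N :=
      pow_le_pow_left₀ (hcos0 x) (by linarith [cos_le_one x]) N
    have hΛ (n : ℕ) : 0 ≤ vonMangoldt n / (n : ℝ) ^ σ :=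
      div_nonneg vonMangoldt_nonneg (rpow_nonneg n.cast_nonneg σ)
    rw [mul_left_comm, mul_left_comm (4 ^ N : ℝ), ← mul_add,
      ← tsum_mul_left (a := K ^ N), ← tsum_mul_left (a := (4 : ℝ) ^ N),
      ← (hs.mul_left _).tsum_add ((hs.indicator A).mul_left _)]
    refine mul_le_mul_of_nonneg_left (Summable.tsum_le_tsum (fun n ↦ ?_) ?_ ?_)
      (sub_pos.mpr hσ).le
    · by_cases hn : n ∈ A
      · rw [Set.indicator_of_mem hn]
        have h1 := mul_le_mul_of_nonneg_left (hcos4 (y * log n + (α - π))) (hΛ n)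
        have h2 := mul_nonneg (by positivity : 0 ≤ K ^ N) (hΛ n)
        linarith
      · rw [Set.indicator_of_notMem hn, mul_zero, add_zero, mul_comm]
        have hcos : cos (y * log n + (α - π)) ≤ cos β := by
          by_contra! hlt
          rw [← add_sub_assoc] at hlt
          have : 0 ≤ log (n : ℝ) := log_natCast_nonneg n
          exact hn (exists_nat_odd_mul_pi_of_cos_lt (by positivity) hβ0 hβπ hlt)
        refine mul_le_mul_of_nonneg_right (pow_le_pow_left₀ (hcos0 _) ?_ N) (hΛ n)
        linarith
    · refine (hs.mul_right ((4 : ℝ) ^ N)).of_nonneg_of_le (fun n ↦ ?_) fun n ↦ ?_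
      · exact mul_nonneg (hΛ n) (pow_nonneg (hcos0 _) N)
      · exact mul_le_mul_of_nonneg_left (hcos4 _) (hΛ n)
    · exact (hs.mul_left _).add ((hs.indicator A).mul_left _)
  linarith
end

section
/- Let y > 0, α ∈ [0, 2π), K ∈ (0, 1). Then the set P⁺ = {p prime : cos(y·ln p + α) > K} is infinite, and likewise P⁻ = {p prime : cos(y·ln p + α) < −K} is infinite. -/
open Real

open ArithmeticFunction Filter Topology

/-- Twisting `Λ` by `n ^ (i t)` shifts the argument of its L-series by `-i t`. -/
lemma term_vonMangoldt_mul_exp (t : ℝ) (s : ℂ) (n : ℕ) :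
    LSeries.term (fun n : ℕ ↦ (vonMangoldt n : ℂ) * Complex.exp (t * Real.log n * Complex.I)) s n =
      LSeries.term (fun n : ℕ ↦ (vonMangoldt n : ℂ)) (s - t * Complex.I) n := by
  rcases eq_or_ne n 0 with rfl | hn
  · simp
  have hn' : (n : ℂ) ≠ 0 := by exact_mod_cast hn
  have h : Complex.exp (t * Real.log n * Complex.I) = (n : ℂ) ^ (t * Complex.I) := by
    rw [Complex.cpow_def_of_ne_zero hn', Complex.natCast_log]
    congr 1
    ring
  rw [LSeries.term_of_ne_zero hn, LSeries.term_of_ne_zero hn, Complex.cpow_sub _ _ hn', h,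
    div_div_eq_mul_div]

lemma LSeriesSummable_vonMangoldt_mul_exp (t : ℝ) {s : ℂ} (hs : 1 < s.re) :
    LSeriesSummable
      (fun n : ℕ ↦ (vonMangoldt n : ℂ) * Complex.exp (t * Real.log n * Complex.I)) s := by
  have h := LSeriesSummable_vonMangoldt (s := s - t * Complex.I) (by simpa using hs)
  exact h.congr fun n ↦ (term_vonMangoldt_mul_exp t s n).symm

lemma tendsto_sub_one_mul_LSeries_vonMangoldt_mul_exp (t : ℝ) :
    Tendsto (fun x : ℝ ↦ ((x : ℂ) - 1) * LSeries
      (fun n : ℕ ↦ (vonMangoldt n : ℂ) * Complex.exp (t * Real.log n * Complex.I)) x)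
      (𝓝[>] 1) (𝓝 (if t = 0 then 1 else 0)) := by
  let A := vonMangoldt.LFunctionResidueClassAux (1 : ZMod 1)
  have hres : (fun n : ℕ ↦ ((vonMangoldt.residueClass (1 : ZMod 1) n : ℝ) : ℂ)) =
      fun n ↦ (vonMangoldt n : ℂ) := by
    ext n
    simp [vonMangoldt.residueClass, Set.indicator, Subsingleton.elim (n : ZMod 1) 1]
  have hlin : Tendsto (fun x : ℝ ↦ (x : ℂ) - 1) (𝓝[>] 1) (𝓝 0) := by
    have : Continuous fun x : ℝ ↦ (x : ℂ) - 1 := by fun_prop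
    simpa using (this.tendsto 1).mono_left nhdsWithin_le_nhds
  have hA : Tendsto (fun x : ℝ ↦ A (x - t * Complex.I)) (𝓝[>] 1) (𝓝 (A (1 - t * Complex.I))) := by
    have hc := vonMangoldt.continuousOn_LFunctionResidueClassAux (1 : ZMod 1)
      (1 - t * Complex.I) (by simp)
    refine hc.tendsto.comp (tendsto_nhdsWithin_iff.2 ⟨?_, ?_⟩)
    · have : Continuous fun x : ℝ ↦ (x : ℂ) - t * Complex.I := by fun_prop
      simpa using (this.tendsto 1).mono_left nhdsWithin_le_nhds
    · filter_upwards [self_mem_nhdsWithin] with x hx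
      simpa using (Set.mem_Ioi.1 hx).le
  have hpole : Tendsto (fun x : ℝ ↦ ((x : ℂ) - 1) / (x - t * Complex.I - 1)) (𝓝[>] 1)
      (𝓝 (if t = 0 then 1 else 0)) := by
    split_ifs with ht
    · refine tendsto_const_nhds.congr' ?_
      filter_upwards [self_mem_nhdsWithin] with x hx
      have : (x : ℂ) - 1 ≠ 0 := by
        exact_mod_cast (sub_pos.2 (Set.mem_Ioi.1 hx)).ne'
      simp [ht, this]
    · have hc : Continuous fun x : ℝ ↦ (x : ℂ) - t * Complex.I - 1 := by fun_prop
      have h := hlin.div ((hc.tendsto 1).mono_left nhdsWithin_le_nhds) (by simp [ht])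
      rw [zero_div] at h
      exact h
  have h := (hlin.mul hA).add hpole
  rw [zero_mul, zero_add] at h
  refine h.congr' ?_
  filter_upwards [self_mem_nhdsWithin] with x hx
  have hx' : (1 : ℝ) < ((x : ℂ) - t * Complex.I).re := by simpa using hx
  have hL : LSeries (fun n : ℕ ↦ (vonMangoldt n : ℂ) * Complex.exp (t * Real.log n * Complex.I)) x =
      LSeries (fun n : ℕ ↦ (vonMangoldt n : ℂ)) (x - t * Complex.I) :=
    tsum_congr fun n ↦ term_vonMangoldt_mul_exp t x n
  have hAx := vonMangoldt.eqOn_LFunctionResidueClassAux (a := (1 : ZMod 1)) isUnit_one hx'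
  simp only [hres, Nat.totient_one, Nat.cast_one, inv_one] at hAx
  rw [hL]
  simp only [A, hAx]
  ring

/-- Fourier expansion of `(2 + 2 cos θ) ^ m`. -/
lemma two_add_two_mul_cos_pow (m : ℕ) (θ : ℝ) :
    (((2 + 2 * Real.cos θ) ^ m : ℝ) : ℂ) = ∑ j ∈ Finset.range (2 * m + 1),
      ((2 * m).choose j : ℂ) * Complex.exp (((j : ℂ) - m) * θ * Complex.I) := by
  have h : (2 : ℂ) + 2 * Complex.cos θ =
      (Complex.exp (θ * Complex.I) + 1) ^ 2 * Complex.exp (-θ * Complex.I) := by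
    have hE : Complex.exp (θ * Complex.I) * Complex.exp (-θ * Complex.I) = 1 := by
      rw [← Complex.exp_add]
      simp
    rw [Complex.cos]
    linear_combination (-Complex.exp (θ * Complex.I) - 2) * hE
  push_cast
  rw [h, mul_pow, ← pow_mul, add_pow, Finset.sum_mul]
  refine Finset.sum_congr rfl fun j _ ↦ ?_
  rw [← Complex.exp_nat_mul, ← Complex.exp_nat_mul, one_pow, mul_one, mul_right_comm,
    ← Complex.exp_add, mul_comm]
  congr 2
  ring

/-- The terms of the von Mangoldt series weighted by a real function. -/
lemma term_vonMangoldt_mul_ofReal (g : ℕ → ℝ) (x : ℝ) (n : ℕ) :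
    LSeries.term (fun n : ℕ ↦ (vonMangoldt n : ℂ) * (g n : ℂ)) x n =
      ((vonMangoldt n * g n / (n : ℝ) ^ x : ℝ) : ℂ) := by
  rcases eq_or_ne n 0 with rfl | hn
  · simp
  rw [LSeries.term_of_ne_zero hn]
  push_cast
  rw [Complex.ofReal_cpow n.cast_nonneg]
  simp

lemma vonMangoldt_mul_cos_pow_eq_sum (y α : ℝ) (m : ℕ) :
    (fun n : ℕ ↦ (vonMangoldt n : ℂ) *
      (((2 + 2 * Real.cos (y * Real.log n + α)) ^ m : ℝ) : ℂ)) =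
    ∑ j ∈ Finset.range (2 * m + 1),
      (((2 * m).choose j : ℂ) * Complex.exp (((j : ℂ) - m) * α * Complex.I)) •
        fun n : ℕ ↦ (vonMangoldt n : ℂ) *
          Complex.exp (((((j : ℝ) - m) * y : ℝ) : ℂ) * Real.log n * Complex.I) := by
  ext n
  rw [two_add_two_mul_cos_pow, Finset.mul_sum, Finset.sum_apply]
  refine Finset.sum_congr rfl fun j _ ↦ ?_
  have : ((j : ℂ) - m) * ((y * Real.log n + α : ℝ) : ℂ) * Complex.I =
      ((j : ℂ) - m) * α * Complex.I +
        ((((j : ℝ) - m) * y : ℝ) : ℂ) * Real.log n * Complex.I := by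
    push_cast
    ring
  rw [this, Complex.exp_add, Pi.smul_apply, smul_eq_mul]
  ring

lemma summable_vonMangoldt_mul_cos_pow (y α : ℝ) (m : ℕ) {x : ℝ} (hx : 1 < x) :
    Summable fun n : ℕ ↦
      vonMangoldt n * (2 + 2 * Real.cos (y * Real.log n + α)) ^ m / (n : ℝ) ^ x := by
  have h : LSeriesSummable (fun n : ℕ ↦ (vonMangoldt n : ℂ) *
      (((2 + 2 * Real.cos (y * Real.log n + α)) ^ m : ℝ) : ℂ)) x := by
    rw [vonMangoldt_mul_cos_pow_eq_sum]
    exact LSeriesSummable.sum fun j _ ↦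
      (LSeriesSummable_vonMangoldt_mul_exp _ (by simpa using hx)).smul _
  exact Complex.summable_ofReal.1 (h.congr fun n ↦ (term_vonMangoldt_mul_ofReal _ x n))

lemma tendsto_sub_one_mul_tsum_vonMangoldt_mul_cos_pow {y : ℝ} (hy : y ≠ 0) (α : ℝ) (m : ℕ) :
    Tendsto (fun x : ℝ ↦ (x - 1) * ∑' n : ℕ,
      vonMangoldt n * (2 + 2 * Real.cos (y * Real.log n + α)) ^ m / (n : ℝ) ^ x)
      (𝓝[>] 1) (𝓝 (m.centralBinom : ℝ)) := by
  have h := tendsto_finsetSum (Finset.range (2 * m + 1)) fun j _ ↦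
    (tendsto_sub_one_mul_LSeries_vonMangoldt_mul_exp (((j : ℝ) - m) * y)).const_mul
      (((2 * m).choose j : ℂ) * Complex.exp (((j : ℂ) - m) * α * Complex.I))
  have hlim : ∑ j ∈ Finset.range (2 * m + 1),
      (((2 * m).choose j : ℂ) * Complex.exp (((j : ℂ) - m) * α * Complex.I)) *
        (if ((j : ℝ) - m) * y = 0 then 1 else 0) = ((m.centralBinom : ℝ) : ℂ) := by
    rw [Finset.sum_eq_single m]
    · simp [Nat.centralBinom]
    · intro j _ hj
      have : (j : ℝ) - m ≠ 0 := sub_ne_zero.2 (by exact_mod_cast hj)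
      simp [this, hy]
    · intro hm
      exact absurd (Finset.mem_range.2 (by omega)) hm
  rw [hlim] at h
  have hre := (Complex.continuous_re.tendsto _).comp h
  rw [Complex.ofReal_re] at hre
  refine hre.congr' ?_
  filter_upwards [self_mem_nhdsWithin] with x hx
  have hL : LSeries (fun n : ℕ ↦ (vonMangoldt n : ℂ) *
      (((2 + 2 * Real.cos (y * Real.log n + α)) ^ m : ℝ) : ℂ)) x =
      ((∑' n : ℕ, vonMangoldt n * (2 + 2 * Real.cos (y * Real.log n + α)) ^ m /
        (n : ℝ) ^ x : ℝ) : ℂ) := by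
    rw [Complex.ofReal_tsum]
    exact tsum_congr fun n ↦ term_vonMangoldt_mul_ofReal _ x n
  rw [vonMangoldt_mul_cos_pow_eq_sum, LSeries_sum fun j _ ↦
    (LSeriesSummable_vonMangoldt_mul_exp _ (by simpa using hx)).smul _] at hL
  simp only [LSeries_smul] at hL
  rw [Function.comp_apply, ← Complex.ofReal_re ((x - 1) * _), Complex.ofReal_mul, ← hL,
    Finset.mul_sum]
  congr 1
  refine Finset.sum_congr rfl fun j _ ↦ ?_
  push_cast
  ring

lemma summable_vonMangoldt_non_primes_div :
    Summable fun n : ℕ ↦ (if n.Prime then 0 else vonMangoldt n) / n := by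
  refine (vonMangoldt.summable_residueClass_non_primes_div (1 : ZMod 1)).congr fun n ↦ ?_
  simp [vonMangoldt.residueClass, Set.indicator, Subsingleton.elim (n : ZMod 1) 1]

lemma exists_mul_centralBinom_lt {r : ℝ} (hr : r < 4) :
    ∃ m : ℕ, r * m.centralBinom < (m + 1).centralBinom := by
  obtain ⟨m, hm⟩ := exists_nat_gt (2 / (4 - r))
  refine ⟨m, ?_⟩
  rw [div_lt_iff₀ (by linarith)] at hm
  have hrec : ((m : ℝ) + 1) * (m + 1).centralBinom = 2 * (2 * m + 1) * m.centralBinom := by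
    exact_mod_cast Nat.succ_mul_centralBinom_succ m
  have hpos : (0 : ℝ) < m.centralBinom := by exact_mod_cast m.centralBinom_pos
  refine lt_of_mul_lt_mul_left (a := (m : ℝ) + 1) ?_ (by positivity)
  rw [hrec]
  nlinarith

theorem infinite_setOf_prime_lt_cos {y K : ℝ} (hy : y ≠ 0) (α : ℝ) (hK : K < 1) :
    {p : ℕ | p.Prime ∧ K < Real.cos (y * Real.log p + α)}.Infinite := by
  intro hfin
  set P := {p : ℕ | p.Prime ∧ K < Real.cos (y * Real.log p + α)}
  obtain ⟨m, hm⟩ := exists_mul_centralBinom_lt (r := 2 + 2 * K) (by linarith)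
  have hlim := (tendsto_sub_one_mul_tsum_vonMangoldt_mul_cos_pow hy α (m + 1)).sub
    ((tendsto_sub_one_mul_tsum_vonMangoldt_mul_cos_pow hy α m).const_mul (2 + 2 * K))
  let B : ℝ := 4 ^ m * (2 + 2 * |K|)
  let b : ℕ → ℝ := fun n ↦
    B * ((if n.Prime then 0 else vonMangoldt n) / n + P.indicator (fun n ↦ vonMangoldt n / n) n)
  have hb : Summable b := (summable_vonMangoldt_non_primes_div.add
    (summable_of_hasFiniteSupport (hfin.subset Set.support_indicator_subset))).mul_left B
  have hbound : ∀ x : ℝ, 1 < x → ∀ n : ℕ,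
      vonMangoldt n * (2 + 2 * Real.cos (y * Real.log n + α)) ^ (m + 1) / (n : ℝ) ^ x -
        (2 + 2 * K) *
          (vonMangoldt n * (2 + 2 * Real.cos (y * Real.log n + α)) ^ m / (n : ℝ) ^ x) ≤ b n := by
    intro x hx n
    rcases eq_or_ne n 0 with rfl | hn
    · simp [b, Set.indicator]
    have hn1 : (1 : ℝ) ≤ n := by exact_mod_cast Nat.one_le_iff_ne_zero.2 hn
    have hnx : (n : ℝ) ≤ (n : ℝ) ^ x := by
      simpa using Real.rpow_le_rpow_of_exponent_le hn1 hx.le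
    set c := Real.cos (y * Real.log n + α)
    have hc1 : c ≤ 1 := Real.cos_le_one _
    have hc0 : 0 ≤ 2 + 2 * c := by linarith [Real.neg_one_le_cos (y * Real.log n + α)]
    have hΛ : 0 ≤ vonMangoldt n := vonMangoldt_nonneg
    have hpow : (2 + 2 * c) ^ m ≤ 4 ^ m := pow_le_pow_left₀ hc0 (by linarith) m
    have hrw : vonMangoldt n * (2 + 2 * c) ^ (m + 1) / (n : ℝ) ^ x -
        (2 + 2 * K) * (vonMangoldt n * (2 + 2 * c) ^ m / (n : ℝ) ^ x) =
        (2 + 2 * c) ^ m * (2 * c - 2 * K) * (vonMangoldt n / (n : ℝ) ^ x) := by ring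
    rw [hrw]
    have hfB : (2 + 2 * c) ^ m * (2 * c - 2 * K) ≤ B := by
      have : 2 * c - 2 * K ≤ 2 + 2 * |K| := by linarith [neg_abs_le K]
      calc _ ≤ (2 + 2 * c) ^ m * (2 + 2 * |K|) := by gcongr
        _ ≤ B := by simp only [B]; gcongr
    have hB : 0 ≤ B := by positivity
    have hlarge : (2 + 2 * c) ^ m * (2 * c - 2 * K) * (vonMangoldt n / (n : ℝ) ^ x) ≤
        B * (vonMangoldt n / n) := by gcongr
    by_cases hp : n.Prime
    · by_cases hnP : n ∈ P
      · simpa [b, hp, hnP] using hlarge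
      · have hcK : c ≤ K := not_lt.1 fun h ↦ hnP ⟨hp, h⟩
        have : (2 + 2 * c) ^ m * (2 * c - 2 * K) ≤ 0 :=
          mul_nonpos_of_nonneg_of_nonpos (by positivity) (by linarith)
        simpa [b, hp, hnP] using mul_nonpos_of_nonpos_of_nonneg this (by positivity)
    · have hnP : n ∉ P := fun h ↦ hp h.1
      simpa [b, hp, hnP] using hlarge
  have hupper : Tendsto (fun x : ℝ ↦ (x - 1) * ∑' n, b n) (𝓝[>] 1) (𝓝 0) := by
    have : Continuous fun x : ℝ ↦ (x - 1) * ∑' n, b n := by fun_prop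
    simpa using (this.tendsto 1).mono_left nhdsWithin_le_nhds
  have hle := le_of_tendsto_of_tendsto hlim hupper <| by
    filter_upwards [self_mem_nhdsWithin] with x hx
    have hx1 : 1 < x := hx
    have h₁ := summable_vonMangoldt_mul_cos_pow y α (m + 1) hx1
    have h₂ := (summable_vonMangoldt_mul_cos_pow y α m hx1).mul_left (2 + 2 * K)
    have h := (h₁.sub h₂).tsum_le_tsum (hbound x hx1) hb
    rw [h₁.tsum_sub h₂, tsum_mul_left] at h
    have := mul_le_mul_of_nonneg_left h (sub_pos.2 hx1).le
    linarith
  linarith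

theorem stmt_14 (y α K : ℝ) (hy : 0 < y) (hα0 : 0 ≤ α) (hα2 : α < 2 * π)
    (hK0 : 0 < K) (hK1 : K < 1) :
    {p : ℕ | p.Prime ∧ K < Real.cos (y * Real.log p + α)}.Infinite ∧
    {p : ℕ | p.Prime ∧ Real.cos (y * Real.log p + α) < -K}.Infinite := by
  refine ⟨infinite_setOf_prime_lt_cos hy.ne' α hK1, ?_⟩
  refine (infinite_setOf_prime_lt_cos hy.ne' (α + π) hK1).mono fun p hp ↦ ⟨hp.1, ?_⟩
  have h := hp.2
  rw [← add_assoc, Real.cos_add_pi] at h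
  linarith
end
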